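/- arXiv:2508.17701 — 2 statements merged into one kernel-verified Lean document; each statement's English description precedes it below -/
import Mathlib

section
/- Let α > 0, x > e², y > 0 and define G(x; α, iy) = ∫_1^x e^{-2πiαu} (1 − log u/log x) u^{iy} du. If 2παx < y ≤ 2παx + sqrt(2παx), then |G(x; α, iy)| ≪ (x/log x) · (1/y), where the implied constant depends only on α. -/
open Real Complex intervalIntegral

/-- `G(x; α, iy) = ∫_1^x e^{-2πiαu} (1 − log u/log x) u^{iy} du`. -/
noncomputable def Gxy (x α y : ℝ) : ℂ :=
  ∫ u in (1:ℝ)..x, Complex.exp (-(2 * π * Complex.I * α * u)) *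
    (1 - Real.log u / Real.log x) * (u : ℂ) ^ (Complex.I * y)

lemma aux_bound (a x y : ℝ) (ha : 0 < a) (hx : 1 < x) (hy : a * x < y) :
    ‖∫ u in (1:ℝ)..x, ((Real.log x - Real.log u : ℝ) : ℂ) *
      Complex.exp (Complex.I * ((y * Real.log u - a * u : ℝ) : ℂ))‖ ≤ 2 / a := by
  set E : ℝ → ℂ := fun u => Complex.exp (Complex.I * ((y * Real.log u - a * u : ℝ) : ℂ)) with hE
  set h : ℝ → ℝ := fun u => u * (Real.log x - Real.log u) / (y - a * u) with hh
  set D : ℝ → ℝ := fun u => (y * (Real.log x - Real.log u) - (y - a * u)) / (y - a * u) ^ 2 with hD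
  set q : ℝ → ℝ := fun u => (y - a * x) / (y - a * u) ^ 2 with hq
  have hx0 : 0 < x := by linarith
  have hI : Set.uIcc 1 x = Set.Icc 1 x := Set.uIcc_of_le hx.le
  have hpos : ∀ u ∈ Set.uIcc 1 x, 0 < u ∧ 0 < y - a * u ∧ u ≤ x := by
    intro u hu
    rw [hI] at hu
    have := mul_le_mul_of_nonneg_left hu.2 ha.le
    exact ⟨by linarith [hu.1], by linarith, hu.2⟩
  have hE1 : ∀ u, ‖E u‖ = 1 := by
    intro u
    simp only [hE]
    rw [mul_comm, Complex.norm_exp_ofReal_mul_I]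
  have hlogc : ContinuousOn Real.log (Set.uIcc 1 x) := fun u hu =>
    (Real.continuousAt_log (hpos u hu).1.ne').continuousWithinAt
  have hEc : ContinuousOn E (Set.uIcc 1 x) := by
    simp only [hE]; fun_prop
  have hDc : ContinuousOn D (Set.uIcc 1 x) := by
    apply ContinuousOn.div (by fun_prop) (by fun_prop)
    intro u hu
    exact pow_ne_zero _ (hpos u hu).2.1.ne'
  have hqc : ContinuousOn q (Set.uIcc 1 x) := by
    apply ContinuousOn.div (by fun_prop) (by fun_prop)
    intro u hu
    exact pow_ne_zero _ (hpos u hu).2.1.ne'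
  have hhd : ∀ u ∈ Set.uIcc 1 x, HasDerivAt h (D u) u := by
    intro u hu
    obtain ⟨h1, h2, h3⟩ := hpos u hu
    have h4 := ((hasDerivAt_id u).mul ((hasDerivAt_const u (Real.log x)).sub
      (Real.hasDerivAt_log h1.ne'))).div
      ((hasDerivAt_const u y).sub ((hasDerivAt_id u).const_mul a)) h2.ne'
    refine h4.congr_deriv ?_
    simp only [hD, id, Pi.sub_apply, Pi.mul_apply]
    field_simp
    ring
  have hKd : ∀ u ∈ Set.uIcc 1 x, HasDerivAt (fun u => h u + 2 * ((y - a * x) / a / (y - a * u)))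
      (D u + 2 * q u) u := by
    intro u hu
    obtain ⟨h1, h2, h3⟩ := hpos u hu
    have h4 := ((hasDerivAt_const u ((y - a * x) / a)).div
      ((hasDerivAt_const u y).sub ((hasDerivAt_id u).const_mul a)) h2.ne').const_mul 2
    refine ((hhd u hu).add h4).congr_deriv ?_
    simp only [hq, id, Pi.sub_apply]
    field_simp
    ring
  have hEd : ∀ u ∈ Set.uIcc 1 x, HasDerivAt E (E u * (Complex.I * ((y / u - a : ℝ) : ℂ))) u := by
    intro u hu
    obtain ⟨h1, h2, h3⟩ := hpos u hu
    have h4 : HasDerivAt (fun u => y * Real.log u - a * u) (y / u - a) u := by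
      refine (((Real.hasDerivAt_log h1.ne').const_mul y).sub
        ((hasDerivAt_id u).const_mul a)).congr_deriv ?_
      simp [div_eq_mul_inv]
    exact (h4.ofReal_comp.const_mul Complex.I).cexp
  have hFd : ∀ u ∈ Set.uIcc 1 x, HasDerivAt (fun u => -Complex.I * ((h u : ℂ) * E u))
      (((Real.log x - Real.log u : ℝ) : ℂ) * E u - Complex.I * ((D u : ℂ) * E u)) u := by
    intro u hu
    obtain ⟨h1, h2, h3⟩ := hpos u hu
    refine (((hhd u hu).ofReal_comp.mul (hEd u hu)).const_mul (-Complex.I)).congr_deriv ?_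
    have h5 : (Real.log x - Real.log u) = h u * (y / u - a) := by
      have h6 : y / u - a = (y - a * u) / u := by field_simp
      have h7 := h2.ne'
      simp only [hh]
      rw [h6, div_mul_div_cancel₀ h7, mul_div_cancel_left₀ _ h1.ne']
    rw [h5]
    push_cast
    linear_combination (-(h u : ℂ) * E u * (y / u - a)) * Complex.I_sq
  have hlogc2 : ContinuousOn (fun u => ((Real.log x - Real.log u : ℝ) : ℂ) * E u)
      (Set.uIcc 1 x) := by fun_prop
  have hDc2 : ContinuousOn (fun u => Complex.I * ((D u : ℂ) * E u)) (Set.uIcc 1 x) := by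
    fun_prop
  have e1 := integral_eq_sub_of_hasDerivAt hFd (hlogc2.sub hDc2).intervalIntegrable
  rw [integral_sub hlogc2.intervalIntegrable hDc2.intervalIntegrable] at e1
  have hKc : ContinuousOn (fun u => D u + 2 * q u) (Set.uIcc 1 x) := by fun_prop
  have e2 := integral_eq_sub_of_hasDerivAt hKd hKc.intervalIntegrable
  have e3 : ‖∫ u in (1:ℝ)..x, Complex.I * ((D u : ℂ) * E u)‖ ≤
      ∫ u in (1:ℝ)..x, (D u + 2 * q u) := by
    apply norm_integral_le_of_norm_le hx.le _ hKc.intervalIntegrable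
    refine Filter.Eventually.of_forall fun u hu => ?_
    have hu' : u ∈ Set.uIcc 1 x := by rw [hI]; exact Set.Ioc_subset_Icc_self hu
    obtain ⟨h1, h2, h3⟩ := hpos u hu'
    rw [norm_mul, norm_mul, hE1, Complex.norm_I, Complex.norm_real, one_mul, mul_one,
      Real.norm_eq_abs]
    have hq0 : 0 ≤ q u := by
      simp only [hq]
      exact div_nonneg (by linarith) (by positivity)
    have hDq : 0 ≤ D u + q u := by
      simp only [hD, hq]
      rw [← add_div]
      apply div_nonneg _ (by positivity)
      have l1 := Real.log_le_sub_one_of_pos (div_pos h1 hx0)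
      rw [Real.log_div h1.ne' hx0.ne'] at l1
      have l2 : 0 ≤ 1 - u / x := by
        rw [sub_nonneg, div_le_one hx0]; exact h3
      have hy0 : 0 < y := lt_trans (mul_pos ha hx0) hy
      have l3 : y * (1 - u / x) ≤ y * (Real.log x - Real.log u) :=
        mul_le_mul_of_nonneg_left (by linarith) hy0.le
      have l4 : a * x * (1 - u / x) ≤ y * (1 - u / x) := mul_le_mul_of_nonneg_right hy.le l2
      have l5 : a * x * (1 - u / x) = a * x - a * u := by field_simp
      linarith
    rw [abs_le]
    constructor <;> linarith
  have hx1 : h x = 0 := by simp [hh]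
  have h10 : 0 ≤ h 1 := by
    obtain ⟨h1, h2, h3⟩ := hpos 1 Set.left_mem_uIcc
    simp only [hh]
    apply div_nonneg _ h2.le
    simp [Real.log_nonneg hx.le]
  have e4 : (∫ u in (1:ℝ)..x, ((Real.log x - Real.log u : ℝ) : ℂ) * E u) =
      Complex.I * ((h 1 : ℂ) * E 1) + ∫ u in (1:ℝ)..x, Complex.I * ((D u : ℂ) * E u) := by
    rw [hx1, Complex.ofReal_zero] at e1
    linear_combination e1
  have e5 : ‖Complex.I * ((h 1 : ℂ) * E 1)‖ = h 1 := by
    rw [norm_mul, norm_mul, hE1, Complex.norm_I, Complex.norm_real, one_mul, mul_one,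
      Real.norm_eq_abs, abs_of_nonneg h10]
  rw [e4]
  refine (norm_add_le _ _).trans ?_
  rw [e5]
  have e6 : 0 ≤ (y - a * x) / a / (y - a * 1) := by
    obtain ⟨h1, h2, h3⟩ := hpos 1 Set.left_mem_uIcc
    exact div_nonneg (div_nonneg (by linarith) ha.le) h2.le
  have e7 : (y - a * x) / a / (y - a * x) = 1 / a := by
    have : y - a * x ≠ 0 := by linarith
    field_simp
  rw [e2, hx1, e7] at e3
  have e8 : 2 / a = 2 * (1 / a) := by ring
  linarith

theorem stmt_11 (α : ℝ) (hα : 0 < α) :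
    ∃ C : ℝ, ∀ x y : ℝ, Real.exp 2 < x →
      2 * π * α * x < y → y ≤ 2 * π * α * x + Real.sqrt (2 * π * α * x) →
      ‖Gxy x α y‖ ≤ C * (x / Real.log x) * (1 / y) := by
  set a : ℝ := 2 * π * α with ha_def
  have ha : 0 < a := by positivity
  refine ⟨2 * (2 * a + 1) / a, fun x y hx hy1 hy2 => ?_⟩
  have hx1 : 1 < x := lt_trans (by simp) hx
  have hx0 : 0 < x := by linarith
  have hax : 0 < a * x := by positivity
  have hy0 : 0 < y := hax.trans hy1
  have hL : 0 < Real.log x := Real.log_pos hx1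
  have hG : Gxy x α y = ((Real.log x)⁻¹ : ℂ) * ∫ u in (1:ℝ)..x,
      ((Real.log x - Real.log u : ℝ) : ℂ) *
      Complex.exp (Complex.I * ((y * Real.log u - a * u : ℝ) : ℂ)) := by
    unfold Gxy
    rw [← intervalIntegral.integral_const_mul]
    apply intervalIntegral.integral_congr
    intro u hu
    rw [Set.uIcc_of_le hx1.le] at hu
    have hu0 : 0 < u := by linarith [hu.1]
    have hLc : (Real.log x : ℂ) ≠ 0 := by exact_mod_cast hL.ne'
    have hexp : Complex.exp (Complex.I * ((y * Real.log u - a * u : ℝ) : ℂ)) =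
        Complex.exp (-(2 * π * Complex.I * α * u)) * (u : ℂ) ^ (Complex.I * y) := by
      rw [Complex.cpow_def_of_ne_zero (by exact_mod_cast hu0.ne'), ← Complex.exp_add,
        ← Complex.ofReal_log hu0.le, ha_def]
      congr 1
      push_cast
      ring
    simp only
    rw [hexp]
    push_cast
    field_simp
  have hB := aux_bound a x y ha hx1 hy1
  have hs : Real.sqrt (a * x) ≤ 1 + a * x := by
    rw [Real.sqrt_le_left (by positivity)]
    nlinarith
  have hyx : y ≤ (2 * a + 1) * x := by nlinarith
  rw [hG, norm_mul, norm_inv, Complex.norm_real, Real.norm_eq_abs, abs_of_pos hL]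
  calc (Real.log x)⁻¹ * _ ≤ (Real.log x)⁻¹ * (2 / a) :=
        mul_le_mul_of_nonneg_left hB (inv_nonneg.2 hL.le)
    _ = (2 / (a * Real.log x * y)) * y := by field_simp
    _ ≤ (2 / (a * Real.log x * y)) * ((2 * a + 1) * x) :=
        mul_le_mul_of_nonneg_left hyx (by positivity)
    _ = _ := by field_simp
end

section
/- Let α > 0, x > e², y > 0 and define G(x; α, iy) = ∫_1^x e^{-2πiαu} (1 − log u/log x) u^{iy} du. If y > 2παx + sqrt(2παx), then |G(x; α, iy)| ≪ 1/y + (x/log x) · (y − 2παx)^{-2}, with implied constant depending only on α. -/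
open Real Complex intervalIntegral

lemma aux_w (L u : ℝ) (hu : 0 < u) :
    HasDerivAt (fun u : ℝ => 1 - Real.log u / L) (-(1 / (u * L))) u := by
  have := ((Real.hasDerivAt_log hu.ne').div_const L).const_sub 1
  refine this.congr_deriv ?_
  field_simp

lemma aux_D (a y u : ℝ) : HasDerivAt (fun u : ℝ => y - a * u) (-a) u := by
  simpa using ((hasDerivAt_id u).const_mul a).const_sub y

lemma aux_h (a y L u : ℝ) (hu : 0 < u) (hL : 0 < L) (hD : 0 < y - a * u) :
    HasDerivAt (fun u : ℝ => u * (1 - Real.log u / L) / (y - a * u))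
      ((y * (1 - Real.log u / L)) / (y - a * u) ^ 2 - 1 / (L * (y - a * u))) u := by
  have := ((hasDerivAt_id u).mul (aux_w L u hu)).div (aux_D a y u) hD.ne'
  refine this.congr_deriv ?_
  simp only [id, Pi.mul_apply]
  generalize Real.log u = l
  have := hD.ne'
  field_simp
  ring

lemma aux_f (a y L u : ℝ) (hu : 0 < u) (hL : 0 < L) (hD : 0 < y - a * u) :
    HasDerivAt (fun u : ℝ => y * (u * (1 - Real.log u / L)) / (y - a * u) ^ 3)
      (y * ((1 - Real.log u / L - 1 / L) * (y - a * u) + 3 * a * u * (1 - Real.log u / L))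
        / (y - a * u) ^ 4) u := by
  have := (((hasDerivAt_id u).mul (aux_w L u hu)).const_mul y).div
    ((aux_D a y u).pow 3) (pow_ne_zero 3 hD.ne')
  refine this.congr_deriv ?_
  simp only [id, Pi.mul_apply, Pi.pow_apply]
  generalize Real.log u = l
  generalize y - a * u = D at hD
  have := hD.ne'
  norm_num
  field_simp
  ring

lemma aux_m (a y L u : ℝ) (hL : 0 < L) (hD : 0 < y - a * u) :
    HasDerivAt (fun u : ℝ => u / (L * (y - a * u) ^ 2))
      ((y + a * u) / (L * (y - a * u) ^ 3)) u := by
  have := (hasDerivAt_id u).div (((aux_D a y u).pow 2).const_mul L)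
    (mul_ne_zero hL.ne' (pow_ne_zero 2 hD.ne'))
  refine this.congr_deriv ?_
  simp only [id, Pi.pow_apply]
  have := hD.ne'
  field_simp
  push_cast
  ring

lemma aux_E (a y u : ℝ) (hu : 0 < u) :
    HasDerivAt (fun u : ℝ => Complex.exp (((y * Real.log u - a * u : ℝ) : ℂ) * Complex.I))
      (Complex.exp (((y * Real.log u - a * u : ℝ) : ℂ) * Complex.I)
        * ((((y - a * u) / u : ℝ) : ℂ) * Complex.I)) u := by
  have h1 : HasDerivAt (fun u : ℝ => y * Real.log u - a * u) ((y - a * u) / u) u := by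
    have := ((Real.hasDerivAt_log hu.ne').const_mul y).sub ((hasDerivAt_id u).const_mul a)
    refine this.congr_deriv ?_
    field_simp
  exact (h1.ofReal_comp.mul_const Complex.I).cexp

lemma aux_integrand (α x y u : ℝ) (hu : 0 < u) :
    Complex.exp (-(2 * π * Complex.I * α * u)) *
    (1 - Real.log u / Real.log x) * (u : ℂ) ^ (Complex.I * y) =
    Complex.exp (((y * Real.log u - (2 * π * α) * u : ℝ) : ℂ) * Complex.I) *
      ((1 - Real.log u / Real.log x : ℝ) : ℂ) := by
  rw [Complex.cpow_def_of_ne_zero (by exact_mod_cast hu.ne'), ← Complex.ofReal_log hu.le,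
    mul_right_comm, ← Complex.exp_add]
  push_cast
  congr 2
  ring

/-- The core estimate. -/
lemma aux_main (a x y L : ℝ) (ha : 0 < a) (hx : 1 < x) (hL : L = Real.log x)
    (hy : a * x < y) :
    ‖∫ u in (1:ℝ)..x, Complex.exp (((y * Real.log u - a * u : ℝ) : ℂ) * Complex.I) *
      ((1 - Real.log u / L : ℝ) : ℂ)‖ ≤
      1 / (y - a) + y / (y - a) ^ 3 + 5 * (x / (L * (y - a * x) ^ 2)) := by
  have hLp : 0 < L := hL ▸ Real.log_pos hx
  have hy0 : 0 < y := lt_trans (by positivity) hy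
  have huI : ∀ u ∈ Set.uIcc 1 x, 0 < u ∧ u ≤ x ∧ 0 < y - a * u ∧ 0 ≤ 1 - Real.log u / L := by
    intro u hu
    rw [Set.uIcc_of_le hx.le] at hu
    have h0 : 0 < u := by linarith [hu.1]
    refine ⟨h0, hu.2, by nlinarith [hu.2], ?_⟩
    rw [sub_nonneg, div_le_one hLp, hL]
    exact Real.log_le_log h0 hu.2
  set E : ℝ → ℂ := fun u => Complex.exp (((y * Real.log u - a * u : ℝ) : ℂ) * Complex.I) with hE
  set w : ℝ → ℝ := fun u => 1 - Real.log u / L with hw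
  set h : ℝ → ℝ := fun u => u * (1 - Real.log u / L) / (y - a * u) with hh
  set f : ℝ → ℝ := fun u => y * (u * (1 - Real.log u / L)) / (y - a * u) ^ 3 with hf
  set m : ℝ → ℝ := fun u => u / (L * (y - a * u) ^ 2) with hm
  set f' : ℝ → ℝ := fun u =>
      (y * ((1 - Real.log u / L - 1 / L) * (y - a * u) + 3 * a * u * (1 - Real.log u / L))
        / (y - a * u) ^ 4) with hf'
  set m' : ℝ → ℝ := fun u => (y + a * u) / (L * (y - a * u) ^ 3) with hm'
  have dF : ∀ u ∈ Set.uIcc 1 x, HasDerivAt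
      (fun u => E u * (((f u - m u : ℝ) : ℂ) - Complex.I * ((h u : ℝ) : ℂ)))
      (E u * ((w u : ℝ) : ℂ) + E u * ((f' u - m' u : ℝ) : ℂ)) u := by
    intro u hu
    obtain ⟨h0, -, hD, -⟩ := huI u hu
    have := (aux_E a y u h0).mul
      ((((aux_f a y L u h0 hLp hD).sub (aux_m a y L u hLp hD)).ofReal_comp).sub
        ((aux_h a y L u h0 hLp hD).ofReal_comp.const_mul Complex.I))
    refine this.congr_deriv ?_
    have e1 : (y - a * u) / u * (f u - m u) =
      (y * (1 - Real.log u / L)) / (y - a * u) ^ 2 - 1 / (L * (y - a * u)) := by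
      simp only [hf, hm]
      generalize Real.log u = l
      have := hD.ne'
      field_simp
    have e2 : (y - a * u) / u * h u = w u := by
      simp only [hh, hw]
      generalize Real.log u = l
      have := hD.ne'
      field_simp
    change E u * _ * (((f u - m u : ℝ) : ℂ) - Complex.I * ((h u : ℝ) : ℂ)) +
      E u * (((f' u - m' u : ℝ) : ℂ) - Complex.I * _) = _
    rw [← e1, ← e2]
    push_cast
    linear_combination (-E u * ((y - a * u) / u) * h u) * Complex.I_sq
  have cE : ContinuousOn E (Set.uIcc 1 x) := fun u hu =>
    (aux_E a y u (huI u hu).1).continuousAt.continuousWithinAt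
  have cw : ContinuousOn w (Set.uIcc 1 x) := fun u hu =>
    (aux_w L u (huI u hu).1).continuousAt.continuousWithinAt
  have cD : ContinuousOn (fun u : ℝ => y - a * u) (Set.uIcc 1 x) := by fun_prop
  have cf' : ContinuousOn f' (Set.uIcc 1 x) := by
    refine ContinuousOn.div ?_ (cD.pow 4) (fun u hu => pow_ne_zero 4 (huI u hu).2.2.1.ne')
    exact continuousOn_const.mul (((cw.sub continuousOn_const).mul cD).add
      ((by fun_prop : ContinuousOn (fun u : ℝ => 3 * a * u) (Set.uIcc 1 x)).mul cw))
  have cm' : ContinuousOn m' (Set.uIcc 1 x) := by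
    refine ContinuousOn.div (by fun_prop) (continuousOn_const.mul (cD.pow 3))
      (fun u hu => mul_ne_zero hLp.ne' (pow_ne_zero 3 (huI u hu).2.2.1.ne'))
  have i1 : IntervalIntegrable (fun u => E u * ((w u : ℝ) : ℂ)) MeasureTheory.volume 1 x :=
    (cE.mul (Complex.continuous_ofReal.comp_continuousOn cw)).intervalIntegrable
  have i2 : IntervalIntegrable (fun u => E u * ((f' u - m' u : ℝ) : ℂ))
      MeasureTheory.volume 1 x :=
    (cE.mul (Complex.continuous_ofReal.comp_continuousOn (cf'.sub cm'))).intervalIntegrable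
  have I1 := intervalIntegral.integral_eq_sub_of_hasDerivAt dF (i1.add i2)
  rw [intervalIntegral.integral_add i1 i2] at I1
  have nE : ∀ u, ‖E u‖ = 1 := fun u => Complex.norm_exp_ofReal_mul_I _
  have i3 : IntervalIntegrable (fun u => f' u + 3 * m' u) MeasureTheory.volume 1 x :=
    (cf'.add (continuousOn_const.mul cm')).intervalIntegrable
  have I2 : ∫ u in (1:ℝ)..x, (f' u + 3 * m' u) = (f x + 3 * m x) - (f 1 + 3 * m 1) :=
    intervalIntegral.integral_eq_sub_of_hasDerivAt (f := fun u => f u + 3 * m u) (fun u hu => by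
      obtain ⟨h0, -, hD, -⟩ := huI u hu
      exact (aux_f a y L u h0 hLp hD).add ((aux_m a y L u hLp hD).const_mul 3)) i3
  have B : ‖∫ u in (1:ℝ)..x, E u * ((f' u - m' u : ℝ) : ℂ)‖ ≤
      ∫ u in (1:ℝ)..x, (f' u + 3 * m' u) := by
    refine intervalIntegral.norm_integral_le_of_norm_le hx.le
      (Filter.Eventually.of_forall fun u hu => ?_) i3
    have hu' : u ∈ Set.uIcc 1 x := by
      rw [Set.uIcc_of_le hx.le]; exact ⟨hu.1.le, hu.2⟩
    obtain ⟨h0, -, hD, hw0⟩ := huI u hu'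
    rw [norm_mul, nE, one_mul, Complex.norm_real, Real.norm_eq_abs]
    have hm0 : 0 ≤ m' u := by simp only [hm']; positivity
    have key : 0 ≤ f' u + m' u := by
      have : f' u + m' u = y * ((1 - Real.log u / L) * (y - a * u)
          + 3 * a * u * (1 - Real.log u / L)) / (y - a * u) ^ 4
          + a * u / (L * (y - a * u) ^ 3) := by
        simp only [hf', hm']
        generalize Real.log u = l
        have := hD.ne'
        field_simp
        ring
      rw [this]
      positivity
    rw [abs_le]; constructor <;> linarith
  have hxm := huI x Set.right_mem_uIcc
  have h1m := huI 1 Set.left_mem_uIcc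
  have wx : 1 - Real.log x / L = 0 := by rw [hL, div_self (hL ▸ hLp.ne')]; ring
  have fx : f x = 0 := by simp [hf, wx]
  have hx0 : h x = 0 := by simp [hh, wx]
  have f1 : f 1 = y / (y - a) ^ 3 := by simp [hf]
  have h1 : h 1 = 1 / (y - a) := by simp [hh]
  have hya : 0 < y - a := by simpa using h1m.2.2.1
  have f1p : 0 ≤ f 1 := by rw [f1]; positivity
  have h1p : 0 ≤ h 1 := by rw [h1]; positivity
  have m1p : 0 ≤ m 1 := by simp only [hm]; positivity
  have m1x : m 1 ≤ m x := by
    simp only [hm]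
    have := hxm.2.2.1
    gcongr
  have N : ∀ u, ‖E u * (((f u - m u : ℝ) : ℂ) - Complex.I * ((h u : ℝ) : ℂ))‖ ≤
      |f u - m u| + |h u| := by
    intro u
    rw [norm_mul, nE, one_mul]
    refine (norm_sub_le _ _).trans ?_
    rw [norm_mul, Complex.norm_I, one_mul, Complex.norm_real, Complex.norm_real]
    rfl
  have Nx := N x
  have N1 := N 1
  rw [fx, hx0, zero_sub, abs_neg, abs_zero, add_zero, abs_of_nonneg (m1p.trans m1x)] at Nx
  have a1 : |f 1 - m 1| ≤ f 1 + m 1 := by rw [abs_le]; constructor <;> linarith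
  rw [abs_of_nonneg h1p] at N1
  have I3 := eq_sub_of_add_eq I1
  rw [I3]
  refine (norm_sub_le _ _).trans ?_
  have T := norm_sub_le
    (E x * (((f x - m x : ℝ) : ℂ) - Complex.I * ((h x : ℝ) : ℂ)))
    (E 1 * (((f 1 - m 1 : ℝ) : ℂ) - Complex.I * ((h 1 : ℝ) : ℂ)))
  rw [I2, fx] at B
  rw [fx, hx0, zero_sub] at T
  rw [← h1, ← f1]
  change _ ≤ h 1 + f 1 + 5 * m x
  simp only [fx, hx0, zero_sub]
  linarith

theorem stmt_12 (α : ℝ) (hα : 0 < α) :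
    ∃ C : ℝ, ∀ x y : ℝ, Real.exp 2 < x →
      2 * π * α * x + Real.sqrt (2 * π * α * x) < y →
      ‖Gxy x α y‖ ≤ C * (1 / y + (x / Real.log x) * (y - 2 * π * α * x)⁻¹ ^ 2) := by
  set a := 2 * π * α with ha_def
  have ha : 0 < a := by positivity
  refine ⟨7 + 8 / a, fun x y hx hy => ?_⟩
  have hx2 : 2 < x := by have := Real.add_one_le_exp 2; linarith
  have hy' : a * x < y := by have := Real.sqrt_nonneg (a * x); linarith
  have hL : 0 < Real.log x := Real.log_pos (by linarith)
  have hG : Gxy x α y = ∫ u in (1:ℝ)..x,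
      Complex.exp (((y * Real.log u - a * u : ℝ) : ℂ) * Complex.I) *
      ((1 - Real.log u / Real.log x : ℝ) : ℂ) := by
    refine intervalIntegral.integral_congr fun u hu => ?_
    rw [Set.uIcc_of_le (by linarith)] at hu
    exact aux_integrand α x y u (by linarith [hu.1])
  rw [hG]
  refine (aux_main a x y _ ha (by linarith) rfl hy').trans ?_
  have hD : 0 < y - a * x := by linarith
  have h2 : y / 2 ≤ y - a := by nlinarith
  have hya : a ≤ y := by nlinarith
  have hy0 : 0 < y := by linarith
  have b1 : 1 / (y - a) ≤ 2 * (1 / y) := by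
    calc 1 / (y - a) ≤ 1 / (y / 2) := by gcongr
      _ = _ := by field_simp
  have b2 : y / (y - a) ^ 3 ≤ 8 / a * (1 / y) := by
    calc y / (y - a) ^ 3 ≤ y / (y / 2) ^ 3 := by gcongr
      _ = 8 / y * (1 / y) := by field_simp; norm_num
      _ ≤ _ := by gcongr
  have e : x / (Real.log x * (y - a * x) ^ 2) = x / Real.log x * (y - a * x)⁻¹ ^ 2 := by
    field_simp
  rw [e]
  have p1 : 0 ≤ x / Real.log x * (y - a * x)⁻¹ ^ 2 := by positivity
  have p2 : 0 ≤ 1 / y := by positivity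
  have p3 : 0 ≤ 8 / a := by positivity
  nlinarith [mul_nonneg p3 p1]
end
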